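/- Let p₀ = (x₀, y₀) ∈ ℝ² with y₀ > 0, let p_t = (x_t, 0) and p_r = (x_r, 0), and set d_t = ‖p₀ − p_t‖, d_r = ‖p₀ − p_r‖, and bistatic range R = d_t + d_r. Define θ̃ = arctan((x₀ − x_t)/y₀) and φ̃ = arctan((x₀ − x_r)/y₀). Then cos θ̃ + cos φ̃ > 0, the receive range satisfies d_r = R·cos θ̃ / (cos θ̃ + cos φ̃), and the target location is recovered as p₀ = ( x_r + d_r·sin φ̃ , d_r·cos φ̃ ). -/

import Mathlib

theorem sqrt_sq_add_sq_mul_cos_arctan_div (x : ℝ) {y : ℝ} (hy : 0 < y) :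
    √(x ^ 2 + y ^ 2) * Real.cos (Real.arctan (x / y)) = y := by
  have h : √(x ^ 2 + y ^ 2) = y * √(1 + (x / y) ^ 2) := by
    rw [← Real.sqrt_sq hy.le, ← Real.sqrt_mul (sq_nonneg y), Real.sqrt_sq hy.le]
    congr 1
    field_simp
    ring
  have h₀ : √(1 + (x / y) ^ 2) ≠ 0 := by positivity
  rw [h, Real.cos_arctan]
  field_simp

theorem sqrt_sq_add_sq_mul_sin_arctan_div (x : ℝ) {y : ℝ} (hy : 0 < y) :
    √(x ^ 2 + y ^ 2) * Real.sin (Real.arctan (x / y)) = x := by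
  rw [← Real.tan_mul_cos (Real.cos_arctan_pos _).ne', Real.tan_arctan, mul_left_comm,
    sqrt_sq_add_sq_mul_cos_arctan_div x hy, div_mul_cancel₀ _ hy.ne']

theorem stmt_13 (x₀ y₀ xt xr : ℝ) (hy₀ : 0 < y₀)
    (p₀ pt pr : EuclideanSpace ℝ (Fin 2))
    (hp₀ : p₀ = ![x₀, y₀]) (hpt : pt = ![xt, 0]) (hpr : pr = ![xr, 0])
    (dt dr R : ℝ) (hdt : dt = ‖p₀ - pt‖) (hdr : dr = ‖p₀ - pr‖) (hR : R = dt + dr)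
    (θ φ : ℝ) (hθ : θ = Real.arctan ((x₀ - xt) / y₀)) (hφ : φ = Real.arctan ((x₀ - xr) / y₀)) :
    0 < Real.cos θ + Real.cos φ ∧
      dr = R * Real.cos θ / (Real.cos θ + Real.cos φ) ∧
      p₀ = ![xr + dr * Real.sin φ, dr * Real.cos φ] := by
  have ht : dt = √((x₀ - xt) ^ 2 + y₀ ^ 2) := by
    rw [hdt, EuclideanSpace.norm_eq]
    simp [hp₀, hpt]
  have hr : dr = √((x₀ - xr) ^ 2 + y₀ ^ 2) := by
    rw [hdr, EuclideanSpace.norm_eq]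
    simp [hp₀, hpr]
  have htc : dt * Real.cos θ = y₀ := by
    rw [ht, hθ, sqrt_sq_add_sq_mul_cos_arctan_div _ hy₀]
  have hrc : dr * Real.cos φ = y₀ := by
    rw [hr, hφ, sqrt_sq_add_sq_mul_cos_arctan_div _ hy₀]
  have hrs : dr * Real.sin φ = x₀ - xr := by
    rw [hr, hφ, sqrt_sq_add_sq_mul_sin_arctan_div _ hy₀]
  have hpos : 0 < Real.cos θ + Real.cos φ := by
    rw [hθ, hφ]
    exact add_pos (Real.cos_arctan_pos _) (Real.cos_arctan_pos _)
  refine ⟨hpos, ?_, ?_⟩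
  · rw [eq_div_iff hpos.ne', hR]
    linear_combination hrc - htc
  · rw [hp₀, hrs, hrc, add_sub_cancel]
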